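/- Single ε-scaling step bound: assume c(x,y) ≥ 0 for all (x,y), let N be a bound with max{|X|,|Y|} ≤ N < ∞, and assume there exists a positive integer M such that M·μ(x) and M·ν(y) are positive integers for all x ∈ X, y ∈ Y. Let ε₁ > ε₂ > 0 and let (α₁,β₁) be a maximizer of J_{ε₁}. Run the asynchronous Sinkhorn iterates with regularization ε₂, kernel K(x,y) := exp(−c(x,y)/ε₂)·μ(x)·ν(y), and initialization v⁰(y) := exp(β₁(y)/ε₂). Then for every q_target ∈ (0,1) there exists a natural number n with n ≤ 2 + (ε₁/ε₂)·(N·(4·log N + 24·log M) + log M)/(1 − q_target) such that q^n ≥ q_target. -/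

import Mathlib

/-- One `u`-update of the Sinkhorn algorithm: `u(x) = μ(x) / Σ_y K(x,y) v(y)`. -/
noncomputable def uOf {X Y : Type*} [Fintype Y] (K : X → Y → ℝ) (μ : X → ℝ)
    (v : Y → ℝ) : X → ℝ :=
  fun x => μ x / ∑ y, K x y * v y

/-- One `v̂`-update of the Sinkhorn algorithm: `v̂(y) = ν(y) / Σ_x K(x,y) u(x)`. -/
noncomputable def vhatOf {X Y : Type*} [Fintype X] (K : X → Y → ℝ) (ν : Y → ℝ)
    (u : X → ℝ) : Y → ℝ :=
  fun y => ν y / ∑ x, K x y * u x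

/-- The `v`-iterates of the asynchronous Sinkhorn algorithm:
`v⁰ = v0`, `v^{ℓ+1}(y) = min (v^ℓ(y), v̂^{ℓ+1}(y))` with
`v̂^{ℓ+1} = vhatOf K ν (uOf K μ (v^ℓ))`. -/
noncomputable def sinkV {X Y : Type*} [Fintype X] [Fintype Y] (K : X → Y → ℝ)
    (μ : X → ℝ) (ν : Y → ℝ) (v0 : Y → ℝ) : ℕ → Y → ℝ
  | 0 => v0
  | ℓ + 1 => fun y =>
      min (sinkV K μ ν v0 ℓ y) (vhatOf K ν (uOf K μ (sinkV K μ ν v0 ℓ)) y)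

/-- First-order optimality for a scalar entropic perturbation. -/
theorem eq_of_forall_mul_le_exp_sub_one {ε p m : ℝ} (hε : 0 < ε)
    (h : ∀ t : ℝ, t * p ≤ ε * (m * (Real.exp (t / ε) - 1))) : m = p := by
  have hd : HasDerivAt (fun t : ℝ => t * p - ε * (m * (Real.exp (t / ε) - 1)))
      (1 * p - ε * (m * (Real.exp (0 / ε) * (1 / ε)))) 0 :=
    ((hasDerivAt_id (0 : ℝ)).mul_const p).sub
      (((((hasDerivAt_id (0 : ℝ)).div_const ε).exp.sub_const 1).const_mul m).const_mul ε)
  have hmax : IsLocalMax (fun t : ℝ => t * p - ε * (m * (Real.exp (t / ε) - 1))) 0 := by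
    refine Filter.Eventually.of_forall fun t => ?_
    have := h t
    simp
    linarith
  have h0 := hmax.hasDerivAt_eq_zero hd
  have : ε * (m * (Real.exp (0 / ε) * (1 / ε))) = m := by
    simp only [zero_div, Real.exp_zero]
    field_simp
  linarith

/-- The entropic coupling of a maximizer of the entropic dual has first marginal `μ`. -/
theorem entropicDual_row_marginal {X Y : Type*} [Fintype X] [Fintype Y]
    (μ : X → ℝ) (ν : Y → ℝ) (c : X → Y → ℝ) {ε : ℝ} (hε : 0 < ε) (α : X → ℝ) (β : Y → ℝ)
    (hopt : ∀ α' : X → ℝ,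
      ∑ x, α' x * μ x + ∑ y, β y * ν y - ε * ∑ x, ∑ y, μ x * ν y *
        (Real.exp ((α' x + β y - c x y) / ε) - Real.exp (-(c x y) / ε)) ≤
      ∑ x, α x * μ x + ∑ y, β y * ν y - ε * ∑ x, ∑ y, μ x * ν y *
        (Real.exp ((α x + β y - c x y) / ε) - Real.exp (-(c x y) / ε))) (x : X) :
    ∑ y, Real.exp ((α x + β y - c x y) / ε) * (μ x * ν y) = μ x := by
  classical
  refine eq_of_forall_mul_le_exp_sub_one hε fun t => ?_
  have h := hopt (fun z => α z + if z = x then t else 0)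
  have h1 : ∑ z, (α z + if z = x then t else 0) * μ z = ∑ z, α z * μ z + t * μ x := by
    simp [add_mul, Finset.sum_add_distrib]
  have h2 : ∑ z, ∑ y, μ z * ν y * (Real.exp (((α z + if z = x then t else 0) + β y - c z y) / ε)
        - Real.exp (-(c z y) / ε)) =
      ∑ z, ∑ y, μ z * ν y * (Real.exp ((α z + β y - c z y) / ε) - Real.exp (-(c z y) / ε)) +
      (∑ y, Real.exp ((α x + β y - c x y) / ε) * (μ x * ν y)) * (Real.exp (t / ε) - 1) := by
    have h3 : ∀ z, ∑ y, μ z * ν y *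
          (Real.exp (((α z + if z = x then t else 0) + β y - c z y) / ε)
          - Real.exp (-(c z y) / ε)) =
        ∑ y, μ z * ν y * (Real.exp ((α z + β y - c z y) / ε) - Real.exp (-(c z y) / ε)) +
        if z = x then
          (∑ y, Real.exp ((α z + β y - c z y) / ε) * (μ z * ν y)) * (Real.exp (t / ε) - 1)
        else 0 := by
      intro z
      split_ifs with hz
      · rw [Finset.sum_mul, ← Finset.sum_add_distrib]
        refine Finset.sum_congr rfl fun y _ => ?_
        rw [show (α z + t + β y - c z y) / ε = (α z + β y - c z y) / ε + t / ε by ring,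
          Real.exp_add]
        ring
      · simp
    rw [Finset.sum_congr rfl fun z _ => h3 z, Finset.sum_add_distrib]
    simp
  rw [h1, h2] at h
  linarith

/-- Two couplings `r μν` and `(r s)^a μν` cannot have the ratio `s` separated by a factor `M²`
away from one across a common cut `A × Bᶜ`, `Aᶜ × B`. -/
theorem no_marginal_cut {X Y : Type*} [Fintype X] [Fintype Y] [DecidableEq X] [DecidableEq Y]
    {μ : X → ℝ} {ν : Y → ℝ} {M a : ℝ} (hM : 1 ≤ M) (ha : 1 ≤ a)
    (hμ1 : ∑ x, μ x = 1) (hν1 : ∑ y, ν y = 1)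
    (hμM : ∀ x, 1 / M ≤ μ x) (hνM : ∀ y, 1 / M ≤ ν y)
    {A : Finset X} {B : Finset Y} (hA : A.Nonempty) (hB : Bᶜ.Nonempty)
    (hAB : ∑ x ∈ A, μ x < ∑ y ∈ B, ν y → ∑ x ∈ A, μ x + 1 / M ≤ ∑ y ∈ B, ν y)
    (hBA : ∑ y ∈ B, ν y < ∑ x ∈ A, μ x → ∑ y ∈ B, ν y + 1 / M ≤ ∑ x ∈ A, μ x)
    {r s : X → Y → ℝ} (hr : ∀ x y, 0 < r x y) (hs : ∀ x y, 0 < s x y)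
    (h1row : ∀ x, ∑ y, r x y * (μ x * ν y) = μ x)
    (h1col : ∀ y, ∑ x, r x y * (μ x * ν y) = ν y)
    (h2row : ∀ x, ∑ y, (r x y * s x y) ^ a * (μ x * ν y) ≤ μ x)
    (h2col : ∀ y ∈ B, ∑ x, (r x y * s x y) ^ a * (μ x * ν y) = ν y)
    (hs1 : ∀ x ∈ A, ∀ y ∈ Bᶜ, M ^ 2 < s x y)
    (hs2 : ∀ x ∈ Aᶜ, ∀ y ∈ B, s x y * M ^ 2 < 1) : False := by
  have hM0 : 0 < M := by linarith
  have hiM : 0 < 1 / M := by positivity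
  have hμ : ∀ x, 0 < μ x := fun x => hiM.trans_le (hμM x)
  have hν : ∀ y, 0 < ν y := fun y => hiM.trans_le (hνM y)
  have hmn : ∀ x y, 0 < μ x * ν y := fun x y => mul_pos (hμ x) (hν y)
  have hMν : ∀ y, 1 ≤ M * ν y := fun y => by
    have := mul_le_mul_of_nonneg_left (hνM y) hM0.le
    rwa [mul_one_div_cancel hM0.ne'] at this
  have hMμ : ∀ x, 1 ≤ M * μ x := fun x => by
    have := mul_le_mul_of_nonneg_left (hμM x) hM0.le
    rwa [mul_one_div_cancel hM0.ne'] at this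
  have hentry : ∀ (g : X → Y → ℝ), (∀ x y, 0 < g x y) →
      (∀ x, ∑ y, g x y * (μ x * ν y) ≤ μ x) → ∀ x y, g x y ≤ M := by
    intro g hg hrow x y
    have h1 : g x y * (μ x * ν y) ≤ μ x :=
      (Finset.single_le_sum (f := fun y => g x y * (μ x * ν y))
        (fun y _ => (mul_pos (hg x y) (hmn x y)).le) (Finset.mem_univ y)).trans (hrow x)
    have h2 : g x y * ν y ≤ 1 := by
      have := hμ x
      by_contra! h
      nlinarith
    nlinarith [hg x y, hMν y, mul_le_mul_of_nonneg_left (hMν y) (hg x y).le]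
  have hr_le : ∀ x y, r x y ≤ M := hentry r hr fun x => (h1row x).le
  have hrs : ∀ x y, 0 < r x y * s x y := fun x y => mul_pos (hr x y) (hs x y)
  have hrsa : ∀ x y, 0 < (r x y * s x y) ^ a := fun x y => Real.rpow_pos_of_pos (hrs x y) a
  have hrs_le : ∀ x y, r x y * s x y ≤ M := by
    intro x y
    have h := hentry (fun x y => (r x y * s x y) ^ a) hrsa h2row x y
    rcases le_total (r x y * s x y) 1 with h1 | h1
    · exact h1.trans hM
    · exact (Real.self_le_rpow_of_one_le h1 ha).trans h
  have hsub : ∀ (S : Finset X) (T : Finset Y), ∑ x ∈ S, ∑ y ∈ T, μ x * ν y ≤ 1 := by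
    intro S T
    rw [← Finset.sum_mul_sum]
    have h1 : ∑ x ∈ S, μ x ≤ 1 := hμ1 ▸ Finset.sum_le_univ_sum_of_nonneg fun x => (hμ x).le
    have h2 : ∑ y ∈ T, ν y ≤ 1 := hν1 ▸ Finset.sum_le_univ_sum_of_nonneg fun y => (hν y).le
    exact mul_le_one₀ h1 (Finset.sum_nonneg fun y _ => (hν y).le) h2
  have hsplit : ∀ Z : X → Y → ℝ, (∑ x ∈ A, ∑ y, Z x y) - ∑ y ∈ B, ∑ x, Z x y =
      (∑ x ∈ A, ∑ y ∈ Bᶜ, Z x y) - ∑ x ∈ Aᶜ, ∑ y ∈ B, Z x y := by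
    intro Z
    have h1 : ∑ x ∈ A, ∑ y, Z x y =
        ∑ x ∈ A, ∑ y ∈ B, Z x y + ∑ x ∈ A, ∑ y ∈ Bᶜ, Z x y := by
      rw [← Finset.sum_add_distrib]
      exact Finset.sum_congr rfl fun x _ => (Finset.sum_add_sum_compl B _).symm
    have h2 : ∑ y ∈ B, ∑ x, Z x y =
        ∑ x ∈ A, ∑ y ∈ B, Z x y + ∑ x ∈ Aᶜ, ∑ y ∈ B, Z x y := by
      rw [Finset.sum_comm, Finset.sum_add_sum_compl]
    linarith
  have hcut1 := hsplit fun x y => r x y * (μ x * ν y)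
  have hcut2 := hsplit fun x y => (r x y * s x y) ^ a * (μ x * ν y)
  rw [Finset.sum_congr rfl fun x _ => h1row x, Finset.sum_congr rfl fun y _ => h1col y] at hcut1
  rw [Finset.sum_congr rfl h2col] at hcut2
  have hrow2 : ∑ x ∈ A, ∑ y, (r x y * s x y) ^ a * (μ x * ν y) ≤ ∑ x ∈ A, μ x :=
    Finset.sum_le_sum fun x _ => h2row x
  set P := ∑ x ∈ A, ∑ y ∈ Bᶜ, r x y * (μ x * ν y) with hP
  set P' := ∑ x ∈ Aᶜ, ∑ y ∈ B, r x y * (μ x * ν y) with hP'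
  set Q := ∑ x ∈ A, ∑ y ∈ Bᶜ, (r x y * s x y) ^ a * (μ x * ν y) with hQ
  set Q' := ∑ x ∈ Aᶜ, ∑ y ∈ B, (r x y * s x y) ^ a * (μ x * ν y) with hQ'
  have hPpos : 0 < P := Finset.sum_pos (fun x _ => Finset.sum_pos
    (fun y _ => mul_pos (hr x y) (hmn x y)) hB) hA
  have hQpos : 0 < Q := Finset.sum_pos (fun x _ => Finset.sum_pos
    (fun y _ => mul_pos (hrsa x y) (hmn x y)) hB) hA
  have hP'nn : 0 ≤ P' := Finset.sum_nonneg fun x _ => Finset.sum_nonneg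
    fun y _ => (mul_pos (hr x y) (hmn x y)).le
  have hbound : ∀ (S : Finset X) (T : Finset Y) (g : X → Y → ℝ) (b : ℝ), 0 ≤ b →
      (∀ x ∈ S, ∀ y ∈ T, g x y ≤ b) → ∑ x ∈ S, ∑ y ∈ T, g x y * (μ x * ν y) ≤ b := by
    intro S T g b hb hg
    calc ∑ x ∈ S, ∑ y ∈ T, g x y * (μ x * ν y) ≤ ∑ x ∈ S, ∑ y ∈ T, b * (μ x * ν y) :=
          Finset.sum_le_sum fun x hx => Finset.sum_le_sum fun y hy =>
            mul_le_mul_of_nonneg_right (hg x hx y hy) (hmn x y).le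
      _ = b * ∑ x ∈ S, ∑ y ∈ T, μ x * ν y := by simp only [Finset.mul_sum]
      _ ≤ b := mul_le_of_le_one_right hb (hsub S T)
  have hbound' : ∀ (g : X → Y → ℝ) (b : ℝ), 0 ≤ b → (∀ x ∈ A, ∀ y ∈ Bᶜ, g x y < b) →
      ∑ x ∈ A, ∑ y ∈ Bᶜ, g x y * (μ x * ν y) < b := by
    intro g b hb hg
    calc ∑ x ∈ A, ∑ y ∈ Bᶜ, g x y * (μ x * ν y) < ∑ x ∈ A, ∑ y ∈ Bᶜ, b * (μ x * ν y) :=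
          Finset.sum_lt_sum_of_nonempty hA fun x hx => Finset.sum_lt_sum_of_nonempty hB
            fun y hy => mul_lt_mul_of_pos_right (hg x hx y hy) (hmn x y)
      _ = b * ∑ x ∈ A, ∑ y ∈ Bᶜ, μ x * ν y := by simp only [Finset.mul_sum]
      _ ≤ b := mul_le_of_le_one_right hb (hsub A Bᶜ)
  have hP_lt : P < 1 / M := by
    refine hbound' r _ hiM.le fun x hx y hy => ?_
    rw [lt_div_iff₀ hM0]
    have h1 := mul_lt_mul_of_pos_left (hs1 x hx y hy) (hr x y)
    by_contra! h
    nlinarith [hrs_le x y]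
  have hQ'_le : Q' ≤ 1 / M := by
    refine hbound _ _ (fun x y => (r x y * s x y) ^ a) _ hiM.le fun x hx y hy => ?_
    have h1 : r x y * s x y ≤ 1 / M := by
      rw [le_div_iff₀ hM0]
      have h2 := hs2 x hx y hy
      have h3 := mul_le_mul_of_nonneg_right (hr_le x y) (mul_pos (hs x y) hM0).le
      nlinarith
    have h2 : r x y * s x y ≤ 1 := h1.trans (by rw [div_le_one hM0]; exact hM)
    exact (Real.rpow_le_self_of_le_one (hrs x y).le h2 ha).trans h1
  have hmass : ∑ x ∈ A, μ x = ∑ y ∈ B, ν y := by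
    rcases lt_trichotomy (∑ x ∈ A, μ x) (∑ y ∈ B, ν y) with h | h | h
    · have := hAB h
      linarith
    · exact h
    · have := hBA h
      linarith
  have hPP' : P = P' := by linarith
  have hQQ' : Q ≤ Q' := by linarith
  have hQ'P : Q' ≤ P ^ a := by
    refine hbound _ _ (fun x y => (r x y * s x y) ^ a) _ (Real.rpow_nonneg hPpos.le a)
      fun x hx y hy => Real.rpow_le_rpow (hrs x y).le ?_ (by linarith)
    have h1 : r x y * (μ x * ν y) ≤ P := by
      rw [hPP']
      exact (Finset.single_le_sum (f := fun y => r x y * (μ x * ν y))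
        (fun y _ => (mul_pos (hr x y) (hmn x y)).le) hy).trans
        (Finset.single_le_sum (f := fun x => ∑ y ∈ B, r x y * (μ x * ν y))
        (fun x _ => Finset.sum_nonneg fun y _ => (mul_pos (hr x y) (hmn x y)).le) hx)
    have h2 : 1 ≤ M ^ 2 * (μ x * ν y) := by nlinarith [hMμ x, hMν y]
    have h3 : r x y ≤ P * M ^ 2 := by nlinarith [hr x y, sq_nonneg M]
    have h4 := hs2 x hx y hy
    nlinarith [hs x y]
  obtain ⟨x, hx, y, hy, hxy⟩ : ∃ x ∈ A, ∃ y ∈ Bᶜ, P ≤ r x y := by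
    by_contra! h
    exact lt_irrefl _ (hbound' r P hPpos.le h)
  have hQ_gt : P ^ a < Q := by
    have h1 : (r x y * s x y) ^ a * (μ x * ν y) ≤ Q :=
      (Finset.single_le_sum (f := fun y => (r x y * s x y) ^ a * (μ x * ν y))
        (fun y _ => (mul_pos (hrsa x y) (hmn x y)).le) hy).trans
        (Finset.single_le_sum (f := fun x => ∑ y ∈ Bᶜ, (r x y * s x y) ^ a * (μ x * ν y))
        (fun x _ => Finset.sum_nonneg fun y _ => (mul_pos (hrsa x y) (hmn x y)).le) hx)
    have h2 : 1 ≤ M ^ 2 * (μ x * ν y) := by nlinarith [hMμ x, hMν y]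
    have h3 : P * M ^ 2 < r x y * s x y :=
      mul_lt_mul' hxy (hs1 x hx y hy) (by positivity) (hr x y)
    have h4 : (P * M ^ 2) ^ a < (r x y * s x y) ^ a :=
      Real.rpow_lt_rpow (by positivity) h3 (by linarith)
    rw [Real.mul_rpow hPpos.le (by positivity)] at h4
    have h5 : M ^ 2 ≤ (M ^ 2) ^ a := Real.self_le_rpow_of_one_le (by nlinarith) ha
    have h6 : 0 < P ^ a := Real.rpow_pos_of_pos hPpos a
    calc P ^ a ≤ P ^ a * (M ^ 2 * (μ x * ν y)) := le_mul_of_one_le_right h6.le h2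
      _ = P ^ a * M ^ 2 * (μ x * ν y) := by ring
      _ ≤ P ^ a * (M ^ 2) ^ a * (μ x * ν y) := by have := hmn x y; gcongr
      _ < (r x y * s x y) ^ a * (μ x * ν y) := mul_lt_mul_of_pos_right h4 (hmn x y)
      _ ≤ Q := h1
  linarith

/-- If every interval `(kD, (k+1)D]` below a value of `f` is hit by `f`, then that value is at most
`D` times the cardinality of the domain. -/
theorem le_card_mul_of_forall_exists_mem_Ioc {ι : Type*} [Fintype ι] (f : ι → ℝ) {D : ℝ}
    (hD : 0 ≤ D) (i : ι)
    (h : ∀ k : ℕ, (k + 1) * D < f i → ∃ j, k * D < f j ∧ f j ≤ (k + 1) * D) :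
    f i ≤ Fintype.card ι * D := by
  by_contra! hi
  have hk : ∀ k : Fin (Fintype.card ι), ((k : ℕ) + 1 : ℝ) * D < f i := fun k =>
    lt_of_le_of_lt (mul_le_mul_of_nonneg_right (by exact_mod_cast k.2) hD) hi
  choose g hg1 hg2 using fun k : Fin (Fintype.card ι) => h k (hk k)
  have hlt : ∀ k l : Fin (Fintype.card ι), k < l → g k ≠ g l := by
    intro k l hkl heq
    have h1 := hg2 k
    have h2 := hg1 l
    rw [heq] at h1
    have h3 : ((k : ℕ) + 1 : ℝ) * D ≤ (l : ℕ) * D :=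
      mul_le_mul_of_nonneg_right (by exact_mod_cast hkl) hD
    linarith
  have hinj : Function.Injective g := by
    intro k l heq
    by_contra hne
    rcases lt_or_gt_of_ne hne with hkl | hkl
    · exact hlt k l hkl heq
    · exact hlt l k hkl heq.symm
  obtain ⟨k, hki⟩ := ((Fintype.bijective_iff_injective_and_card g).2 ⟨hinj, by simp⟩).2 i
  have h1 := hg2 k
  rw [hki] at h1
  exact absurd (hk k) (not_lt.2 h1)

/-- Subset masses of two vectors with entries in `ℕ / M` differ by at least `1 / M`
unless they agree. -/
theorem sum_add_one_div_le_of_lt {X Y : Type*} {μ : X → ℝ} {ν : Y → ℝ} {M : ℕ} (hM : 0 < M)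
    (hμ : ∀ x, ∃ k : ℕ, 0 < k ∧ (M : ℝ) * μ x = k) (hν : ∀ y, ∃ k : ℕ, 0 < k ∧ (M : ℝ) * ν y = k)
    (A : Finset X) (B : Finset Y) (h : ∑ x ∈ A, μ x < ∑ y ∈ B, ν y) :
    ∑ x ∈ A, μ x + 1 / (M : ℝ) ≤ ∑ y ∈ B, ν y := by
  choose k _ hk using hμ
  choose l _ hl using hν
  have hM0 : (0 : ℝ) < M := by exact_mod_cast hM
  have h1 : (M : ℝ) * ∑ x ∈ A, μ x = ((∑ x ∈ A, k x : ℕ) : ℝ) := by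
    push_cast
    rw [Finset.mul_sum]
    exact Finset.sum_congr rfl fun x _ => hk x
  have h2 : (M : ℝ) * ∑ y ∈ B, ν y = ((∑ y ∈ B, l y : ℕ) : ℝ) := by
    push_cast
    rw [Finset.mul_sum]
    exact Finset.sum_congr rfl fun x _ => hl x
  have h3 := mul_lt_mul_of_pos_left h hM0
  rw [h1, h2, Nat.cast_lt] at h3
  have h4 : ((∑ x ∈ A, k x : ℕ) : ℝ) + 1 ≤ ((∑ y ∈ B, l y : ℕ) : ℝ) := by exact_mod_cast h3
  rw [← h1, ← h2] at h4
  refine le_of_mul_le_mul_left ?_ hM0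
  rw [mul_add, mul_one_div_cancel hM0.ne']
  exact h4

/-- Drift bound: if `exp (w/ε₁) μν` is a coupling and `exp ((w+d-e)/ε₂) μν` is a subcoupling
that saturates the columns with `e > 0`, then `d` is bounded as soon as some `e y` is
nonpositive. -/
theorem dual_drift_le {X Y : Type*} [Fintype X] [Fintype Y] {μ : X → ℝ} {ν : Y → ℝ}
    (hμ1 : ∑ x, μ x = 1) (hν1 : ∑ y, ν y = 1) {M : ℕ} (hM : 0 < M)
    (hμint : ∀ x, ∃ k : ℕ, 0 < k ∧ (M : ℝ) * μ x = k)
    (hνint : ∀ y, ∃ k : ℕ, 0 < k ∧ (M : ℝ) * ν y = k)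
    {ε₁ ε₂ : ℝ} (hε₂ : 0 < ε₂) (hε : ε₂ < ε₁) {w : X → Y → ℝ} {d : X → ℝ} {e : Y → ℝ}
    (h1row : ∀ x, ∑ y, Real.exp (w x y / ε₁) * (μ x * ν y) = μ x)
    (h1col : ∀ y, ∑ x, Real.exp (w x y / ε₁) * (μ x * ν y) = ν y)
    (h2row : ∀ x, ∑ y, Real.exp ((w x y + d x - e y) / ε₂) * (μ x * ν y) ≤ μ x)
    (h2col : ∀ y, 0 < e y → ∑ x, Real.exp ((w x y + d x - e y) / ε₂) * (μ x * ν y) = ν y)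
    {y₀ : Y} (hy₀ : e y₀ ≤ 0) (x₀ : X) :
    d x₀ ≤ (Fintype.card X + Fintype.card Y) * (2 * ε₁ * Real.log M) := by
  classical
  have hε₁ : 0 < ε₁ := hε₂.trans hε
  have hM1 : (1 : ℝ) ≤ M := by exact_mod_cast hM
  have hM0 : (0 : ℝ) < M := by linarith
  have hlog : 0 ≤ Real.log M := Real.log_nonneg hM1
  have hD : 0 ≤ 2 * ε₁ * Real.log M := by positivity
  have hge : ∀ z : ℝ, (∃ k : ℕ, 0 < k ∧ (M : ℝ) * z = k) → 1 / (M : ℝ) ≤ z := by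
    rintro z ⟨k, hk, hz⟩
    rw [div_le_iff₀ hM0, mul_comm, hz]
    exact_mod_cast hk
  have hexp2 : Real.exp (2 * Real.log M) = (M : ℝ) ^ 2 := by
    rw [mul_comm, Real.exp_mul, Real.exp_log hM0]
    norm_cast
  have hrs : ∀ x y, (Real.exp (w x y / ε₁) * Real.exp ((d x - e y) / ε₁)) ^ (ε₁ / ε₂) =
      Real.exp ((w x y + d x - e y) / ε₂) := by
    intro x y
    rw [← Real.exp_add, ← Real.exp_mul]
    congr 1
    field_simp
    ring
  have key := le_card_mul_of_forall_exists_mem_Ioc (Sum.elim d e) hD (Sum.inl x₀) ?_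
  · simpa [Fintype.card_sum] using key
  intro k hk
  by_contra! hgap
  have hkD : 0 ≤ (k : ℝ) * (2 * ε₁ * Real.log M) := by positivity
  have hgd : ∀ x, ¬ (k + 1) * (2 * ε₁ * Real.log M) < d x → d x ≤ k * (2 * ε₁ * Real.log M) :=
    fun x hx => by
      by_contra! h
      exact hx (hgap (Sum.inl x) h)
  have hge' : ∀ y, ¬ (k + 1) * (2 * ε₁ * Real.log M) < e y → e y ≤ k * (2 * ε₁ * Real.log M) :=
    fun y hy => by
      by_contra! h
      exact hy (hgap (Sum.inr y) h)
  refine no_marginal_cut (A := Finset.univ.filter fun x => (k + 1) * (2 * ε₁ * Real.log M) < d x)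
    (B := Finset.univ.filter fun y => (k + 1) * (2 * ε₁ * Real.log M) < e y)
    (r := fun x y => Real.exp (w x y / ε₁)) (s := fun x y => Real.exp ((d x - e y) / ε₁))
    hM1 ((one_le_div hε₂).2 hε.le) hμ1 hν1 (fun x => hge _ (hμint x)) (fun y => hge _ (hνint y))
    ⟨x₀, by simpa using hk⟩ ⟨y₀, ?_⟩
    (sum_add_one_div_le_of_lt hM hμint hνint _ _) (sum_add_one_div_le_of_lt hM hνint hμint _ _)
    (fun _ _ => Real.exp_pos _) (fun _ _ => Real.exp_pos _) h1row h1col ?_ ?_ ?_ ?_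
  · simp only [Finset.mem_compl, Finset.mem_filter, Finset.mem_univ, true_and, not_lt]
    nlinarith
  · intro x
    simp only [hrs]
    exact h2row x
  · intro y hy
    simp only [hrs]
    simp only [Finset.mem_filter, Finset.mem_univ, true_and] at hy
    exact h2col y (by nlinarith)
  · intro x hx y hy
    simp only [Finset.mem_compl, Finset.mem_filter, Finset.mem_univ, true_and] at hx hy
    have := hge' y hy
    rw [← hexp2, Real.exp_lt_exp, lt_div_iff₀ hε₁]
    linarith
  · intro x hx y hy
    simp only [Finset.mem_compl, Finset.mem_filter, Finset.mem_univ, true_and] at hx hy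
    have := hgd x hx
    rw [← hexp2, ← Real.exp_add, Real.exp_lt_one_iff, div_add' _ _ _ hε₁.ne', div_lt_iff₀ hε₁]
    linarith

section Sinkhorn

variable {X Y : Type*} {K : X → Y → ℝ} {μ : X → ℝ} {ν : Y → ℝ}

theorem uOf_pos [Fintype Y] [Nonempty Y] (hK : ∀ x y, 0 < K x y) (hμ : ∀ x, 0 < μ x) {v : Y → ℝ}
    (hv : ∀ y, 0 < v y) (x : X) : 0 < uOf K μ v x :=
  div_pos (hμ x) (Finset.sum_pos (fun y _ => mul_pos (hK x y) (hv y)) Finset.univ_nonempty)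

theorem vhatOf_pos [Fintype X] [Nonempty X] (hK : ∀ x y, 0 < K x y) (hν : ∀ y, 0 < ν y) {u : X → ℝ}
    (hu : ∀ x, 0 < u x) (y : Y) : 0 < vhatOf K ν u y :=
  div_pos (hν y) (Finset.sum_pos (fun x _ => mul_pos (hK x y) (hu x)) Finset.univ_nonempty)

theorem uOf_anti [Fintype Y] [Nonempty Y] (hK : ∀ x y, 0 < K x y) (hμ : ∀ x, 0 < μ x) {v v' : Y → ℝ}
    (hv : ∀ y, 0 < v y) (h : ∀ y, v y ≤ v' y) (x : X) : uOf K μ v' x ≤ uOf K μ v x :=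
  div_le_div_of_nonneg_left (hμ x).le
    (Finset.sum_pos (fun y _ => mul_pos (hK x y) (hv y)) Finset.univ_nonempty)
    (Finset.sum_le_sum fun y _ => mul_le_mul_of_nonneg_left (h y) (hK x y).le)

theorem vhatOf_anti [Fintype X] [Nonempty X] (hK : ∀ x y, 0 < K x y) (hν : ∀ y, 0 < ν y) {u u' : X → ℝ}
    (hu : ∀ x, 0 < u x) (h : ∀ x, u x ≤ u' x) (y : Y) : vhatOf K ν u' y ≤ vhatOf K ν u y :=
  div_le_div_of_nonneg_left (hν y).le
    (Finset.sum_pos (fun x _ => mul_pos (hK x y) (hu x)) Finset.univ_nonempty)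
    (Finset.sum_le_sum fun x _ => mul_le_mul_of_nonneg_left (h x) (hK x y).le)

theorem sum_mul_vhatOf [Fintype X] [Nonempty X] (hK : ∀ x y, 0 < K x y) {u : X → ℝ} (hu : ∀ x, 0 < u x) (y : Y) :
    ∑ x, u x * K x y * vhatOf K ν u y = ν y := by
  have h : 0 < ∑ x, K x y * u x :=
    Finset.sum_pos (fun x _ => mul_pos (hK x y) (hu x)) Finset.univ_nonempty
  calc ∑ x, u x * K x y * vhatOf K ν u y = vhatOf K ν u y * ∑ x, K x y * u x := by
        rw [Finset.mul_sum]
        exact Finset.sum_congr rfl fun x _ => by ring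
    _ = ν y := div_mul_cancel₀ _ h.ne'

/-- The mass missing in the primal iterate is a lower bound on the ascent of `∑ μ log u`. -/
theorem one_sub_mass_le_log_ascent [Fintype X] [Fintype Y] [Nonempty Y]
    (hK : ∀ x y, 0 < K x y) (hμ : ∀ x, 0 < μ x)
    (hμ1 : ∑ x, μ x = 1) {u : X → ℝ} (hu : ∀ x, 0 < u x) {v : Y → ℝ} (hv : ∀ y, 0 < v y) :
    1 - ∑ x, ∑ y, u x * K x y * v y ≤
      ∑ x, μ x * Real.log (uOf K μ v x) - ∑ x, μ x * Real.log (u x) := by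
  rw [← hμ1, ← Finset.sum_sub_distrib, ← Finset.sum_sub_distrib]
  refine Finset.sum_le_sum fun x _ => ?_
  have hS : 0 < ∑ y, K x y * v y :=
    Finset.sum_pos (fun y _ => mul_pos (hK x y) (hv y)) Finset.univ_nonempty
  have hrow : ∑ y, u x * K x y * v y = u x * ∑ y, K x y * v y := by
    rw [Finset.mul_sum]
    exact Finset.sum_congr rfl fun y _ => by ring
  have hlog := Real.log_le_sub_one_of_pos (div_pos (hu x) (uOf_pos hK hμ hv x))
  rw [Real.log_div (hu x).ne' (uOf_pos hK hμ hv x).ne'] at hlog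
  have h1 : μ x * (u x / uOf K μ v x) = u x * ∑ y, K x y * v y := by
    have := hμ x
    unfold uOf
    field_simp
  rw [hrow, ← h1]
  nlinarith [mul_le_mul_of_nonneg_left hlog (hμ x).le]

variable [Fintype X] [Fintype Y] [Nonempty X] [Nonempty Y] {v0 : Y → ℝ}

theorem sinkV_pos (hK : ∀ x y, 0 < K x y) (hμ : ∀ x, 0 < μ x) (hν : ∀ y, 0 < ν y)
    (hv0 : ∀ y, 0 < v0 y) (ℓ : ℕ) (y : Y) : 0 < sinkV K μ ν v0 ℓ y := by
  induction ℓ generalizing y with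
  | zero => exact hv0 y
  | succ ℓ ih => exact lt_min (ih y) (vhatOf_pos hK hν (uOf_pos hK hμ ih) y)

/-- An entry of the `v`-iterate that has left its initial value equals the unclipped update. -/
theorem sinkV_eq_init_or_eq_vhatOf (hK : ∀ x y, 0 < K x y) (hμ : ∀ x, 0 < μ x)
    (hν : ∀ y, 0 < ν y) (hv0 : ∀ y, 0 < v0 y) (ℓ : ℕ) (y : Y) :
    sinkV K μ ν v0 (ℓ + 1) y = v0 y ∨
      sinkV K μ ν v0 (ℓ + 1) y = vhatOf K ν (uOf K μ (sinkV K μ ν v0 ℓ)) y := by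
  have hpos := sinkV_pos hK hμ hν hv0
  induction ℓ with
  | zero => exact min_choice _ _
  | succ ℓ ih =>
    rcases min_choice (sinkV K μ ν v0 (ℓ + 1) y)
      (vhatOf K ν (uOf K μ (sinkV K μ ν v0 (ℓ + 1))) y) with h | h
    · rcases ih with h' | h'
      · exact Or.inl (h.trans h')
      · right
        refine le_antisymm (min_le_right _ _) ?_
        refine le_trans ?_ (h.trans h').ge
        exact vhatOf_anti hK hν (uOf_pos hK hμ (hpos ℓ))
          (uOf_anti hK hμ (hpos (ℓ + 1)) fun y => min_le_left _ _) y
    · exact Or.inr h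

theorem sum_uOf_mul_sinkV_le (hK : ∀ x y, 0 < K x y) (hμ : ∀ x, 0 < μ x)
    (hν : ∀ y, 0 < ν y) (hv0 : ∀ y, 0 < v0 y) (ℓ : ℕ) (x : X) :
    ∑ y, uOf K μ (sinkV K μ ν v0 ℓ) x * K x y * sinkV K μ ν v0 (ℓ + 1) y ≤ μ x := by
  have hpos := sinkV_pos hK hμ hν hv0
  have hu := uOf_pos hK hμ (hpos ℓ) x
  calc ∑ y, uOf K μ (sinkV K μ ν v0 ℓ) x * K x y * sinkV K μ ν v0 (ℓ + 1) y
      ≤ ∑ y, uOf K μ (sinkV K μ ν v0 ℓ) x * K x y * sinkV K μ ν v0 ℓ y :=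
        Finset.sum_le_sum fun y _ => mul_le_mul_of_nonneg_left (min_le_left _ _)
          (mul_pos hu (hK x y)).le
    _ = uOf K μ (sinkV K μ ν v0 ℓ) x * ∑ y, K x y * sinkV K μ ν v0 ℓ y := by
        rw [Finset.mul_sum]
        exact Finset.sum_congr rfl fun y _ => by ring
    _ = μ x := div_mul_cancel₀ _
        (Finset.sum_pos (fun y _ => mul_pos (hK x y) (hpos ℓ y)) Finset.univ_nonempty).ne'

end Sinkhorn

/-- Iteration bound for a single ε-scaling step of the asynchronous Sinkhorn
algorithm, initialized with the optimal dual variable of the previous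
regularization parameter. -/
theorem single_eps_scaling_step_bound
    {X Y : Type*} [Fintype X] [Fintype Y] [Nonempty X] [Nonempty Y]
    (μ : X → ℝ) (ν : Y → ℝ) (hμ : ∀ x, 0 < μ x) (hν : ∀ y, 0 < ν y)
    (hμ1 : ∑ x, μ x = 1) (hν1 : ∑ y, ν y = 1)
    (c : X → Y → ℝ) (hc : ∀ x y, 0 ≤ c x y)
    (N : ℕ) (hNX : Fintype.card X ≤ N) (hNY : Fintype.card Y ≤ N)
    (M : ℕ) (hM : 0 < M)
    (hμint : ∀ x, ∃ k : ℕ, 0 < k ∧ (M : ℝ) * μ x = (k : ℝ))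
    (hνint : ∀ y, ∃ k : ℕ, 0 < k ∧ (M : ℝ) * ν y = (k : ℝ))
    (ε₁ ε₂ : ℝ) (hε₂ : 0 < ε₂) (hε : ε₂ < ε₁)
    (J : ℝ → (X → ℝ) → (Y → ℝ) → ℝ)
    (hJ : ∀ ε α β, J ε α β = ∑ x, α x * μ x + ∑ y, β y * ν y -
      ε * ∑ x, ∑ y, μ x * ν y *
        (Real.exp ((α x + β y - c x y) / ε) - Real.exp (-(c x y) / ε)))
    (α₁ : X → ℝ) (β₁ : Y → ℝ)
    (hopt₁ : ∀ (α : X → ℝ) (β : Y → ℝ), J ε₁ α β ≤ J ε₁ α₁ β₁)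
    (K : X → Y → ℝ) (hK : ∀ x y, K x y = Real.exp (-(c x y) / ε₂) * μ x * ν y)
    (v0 : Y → ℝ) (hv0 : ∀ y, v0 y = Real.exp (β₁ y / ε₂))
    (v : ℕ → Y → ℝ) (hv : ∀ ℓ, v ℓ = sinkV K μ ν v0 ℓ)
    (u : ℕ → X → ℝ) (hu : ∀ ℓ, u ℓ = uOf K μ (v (ℓ - 1)))
    (π : ℕ → X → Y → ℝ) (hπ : ∀ ℓ x y, π ℓ x y = u ℓ x * K x y * v ℓ y)
    (q : ℕ → ℝ) (hq : ∀ ℓ, q ℓ = ∑ x, ∑ y, π ℓ x y) :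
    ∀ qt : ℝ, 0 < qt → qt < 1 →
      ∃ n : ℕ, 1 ≤ n ∧
        (n : ℝ) ≤ 2 + (ε₁ / ε₂) *
          ((N * (4 * Real.log N + 24 * Real.log M) + Real.log M) / (1 - qt)) ∧
        qt ≤ q n := by
  intro qt hqt0 hqt1
  have hε₁ : 0 < ε₁ := hε₂.trans hε
  have hM1 : (1 : ℝ) ≤ M := by exact_mod_cast hM
  have hM0 : (0 : ℝ) < M := by linarith
  have hlogM : 0 ≤ Real.log M := Real.log_nonneg hM1
  have hlogN : 0 ≤ Real.log N := Real.log_natCast_nonneg N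
  have ha : 0 < ε₁ / ε₂ := div_pos hε₁ hε₂
  have hKpos : ∀ x y, 0 < K x y := fun x y => by
    rw [hK]
    exact mul_pos (mul_pos (Real.exp_pos _) (hμ x)) (hν y)
  have hv0pos : ∀ y, 0 < v0 y := fun y => by
    rw [hv0]
    exact Real.exp_pos _
  have hVpos := sinkV_pos hKpos hμ hν hv0pos
  have hUpos : ∀ ℓ x, 0 < uOf K μ (sinkV K μ ν v0 ℓ) x := fun ℓ => uOf_pos hKpos hμ (hVpos ℓ)
  have hqs : ∀ ℓ, q (ℓ + 1) = ∑ x, ∑ y,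
      uOf K μ (sinkV K μ ν v0 ℓ) x * K x y * sinkV K μ ν v0 (ℓ + 1) y := by
    intro ℓ
    simp only [hq, hπ, hu, hv, Nat.add_sub_cancel]
  have h1row : ∀ x, ∑ y, Real.exp ((α₁ x + β₁ y - c x y) / ε₁) * (μ x * ν y) = μ x :=
    entropicDual_row_marginal μ ν c hε₁ α₁ β₁ fun α' => by
      have := hopt₁ α' β₁
      rwa [hJ, hJ] at this
  have h1col : ∀ y, ∑ x, Real.exp ((α₁ x + β₁ y - c x y) / ε₁) * (μ x * ν y) = ν y := by
    intro y
    have hswap : ∀ β : Y → ℝ, J ε₁ α₁ β = ∑ y, β y * ν y + ∑ x, α₁ x * μ x -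
        ε₁ * ∑ y, ∑ x, ν y * μ x *
          (Real.exp ((β y + α₁ x - c x y) / ε₁) - Real.exp (-(c x y) / ε₁)) := by
      intro β
      rw [hJ, Finset.sum_comm]
      simp only [mul_comm, add_comm]
    have h := entropicDual_row_marginal ν μ (fun y x => c x y) hε₁ β₁ α₁ (fun β' => by
      have := hopt₁ α₁ β'
      rwa [hswap, hswap] at this) y
    simpa only [mul_comm, add_comm] using h
  have hw : ∀ x y, α₁ x + β₁ y - c x y ≤ ε₁ * Real.log M := by
    intro x y
    have h1 : Real.exp ((α₁ x + β₁ y - c x y) / ε₁) * (μ x * ν y) ≤ μ x :=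
      (Finset.single_le_sum (f := fun y => Real.exp ((α₁ x + β₁ y - c x y) / ε₁) * (μ x * ν y))
        (fun y _ => (mul_pos (Real.exp_pos _) (mul_pos (hμ x) (hν y))).le)
        (Finset.mem_univ y)).trans (h1row x).le
    have h2 : Real.exp ((α₁ x + β₁ y - c x y) / ε₁) * ν y ≤ 1 := by
      have := hμ x
      by_contra! h
      nlinarith
    have h3 : 1 ≤ M * ν y := by
      obtain ⟨k, hk, hk'⟩ := hνint y
      rw [hk']
      exact_mod_cast hk
    have h4 : Real.exp ((α₁ x + β₁ y - c x y) / ε₁) ≤ M := by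
      nlinarith [mul_le_mul_of_nonneg_left h3 (Real.exp_pos ((α₁ x + β₁ y - c x y) / ε₁)).le]
    have h5 := (Real.le_log_iff_exp_le hM0).2 h4
    rwa [div_le_iff₀ hε₁, mul_comm] at h5
  have hlow : ∀ x, α₁ x / ε₂ - ε₁ / ε₂ * Real.log M ≤ Real.log (uOf K μ v0 x) := by
    intro x
    rw [Real.le_log_iff_exp_le (uOf_pos hKpos hμ hv0pos x), uOf, le_div_iff₀
      (Finset.sum_pos (fun y _ => mul_pos (hKpos x y) (hv0pos y)) Finset.univ_nonempty),
      Finset.mul_sum]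
    calc ∑ y, Real.exp (α₁ x / ε₂ - ε₁ / ε₂ * Real.log M) * (K x y * v0 y)
        ≤ ∑ y, μ x * ν y := by
          refine Finset.sum_le_sum fun y _ => ?_
          have h : Real.exp (α₁ x / ε₂ - ε₁ / ε₂ * Real.log M) * (K x y * v0 y) =
              Real.exp ((α₁ x + β₁ y - c x y - ε₁ * Real.log M) / ε₂) * (μ x * ν y) := by
            rw [hK, hv0, show (α₁ x + β₁ y - c x y - ε₁ * Real.log M) / ε₂ =
              (α₁ x / ε₂ - ε₁ / ε₂ * Real.log M) + -(c x y) / ε₂ + β₁ y / ε₂ by ring,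
              Real.exp_add, Real.exp_add]
            ring
          rw [h]
          refine mul_le_of_le_one_left (mul_pos (hμ x) (hν y)).le (Real.exp_le_one_iff.2 ?_)
          exact div_nonpos_of_nonpos_of_nonneg (by linarith [hw x y]) hε₂.le
      _ = μ x := by rw [← Finset.mul_sum, hν1, mul_one]
  have hup : ∀ ℓ, q (ℓ + 1) < 1 → ∀ x, Real.log (uOf K μ (sinkV K μ ν v0 ℓ) x) ≤
      α₁ x / ε₂ + ε₁ / ε₂ * (4 * N * Real.log M) := by
    intro ℓ hlt x
    have hπexp : ∀ x y, uOf K μ (sinkV K μ ν v0 ℓ) x * K x y * sinkV K μ ν v0 (ℓ + 1) y =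
        Real.exp ((α₁ x + β₁ y - c x y +
          (ε₂ * Real.log (uOf K μ (sinkV K μ ν v0 ℓ) x) - α₁ x) -
          (β₁ y - ε₂ * Real.log (sinkV K μ ν v0 (ℓ + 1) y))) / ε₂) * (μ x * ν y) := by
      intro x y
      rw [show (α₁ x + β₁ y - c x y +
          (ε₂ * Real.log (uOf K μ (sinkV K μ ν v0 ℓ) x) - α₁ x) -
          (β₁ y - ε₂ * Real.log (sinkV K μ ν v0 (ℓ + 1) y))) / ε₂ =
          Real.log (uOf K μ (sinkV K μ ν v0 ℓ) x) + -(c x y) / ε₂ +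
            Real.log (sinkV K μ ν v0 (ℓ + 1) y) by field_simp; ring,
        Real.exp_add, Real.exp_add, Real.exp_log (hUpos ℓ x), Real.exp_log (hVpos (ℓ + 1) y), hK]
      ring
    have he_init : ∀ y, sinkV K μ ν v0 (ℓ + 1) y = v0 y →
        β₁ y - ε₂ * Real.log (sinkV K μ ν v0 (ℓ + 1) y) = 0 := by
      intro y hy
      rw [hy, hv0, Real.log_exp]
      field_simp
      ring
    have hcol : ∀ y, sinkV K μ ν v0 (ℓ + 1) y ≠ v0 y →
        ∑ x, uOf K μ (sinkV K μ ν v0 ℓ) x * K x y * sinkV K μ ν v0 (ℓ + 1) y = ν y := by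
      intro y hy
      rw [(sinkV_eq_init_or_eq_vhatOf hKpos hμ hν hv0pos ℓ y).resolve_left hy]
      exact sum_mul_vhatOf hKpos (hUpos ℓ) y
    obtain ⟨y₀, hy₀⟩ : ∃ y, sinkV K μ ν v0 (ℓ + 1) y = v0 y := by
      by_contra! hne
      rw [hqs, Finset.sum_comm, Finset.sum_congr rfl fun y _ => hcol y (hne y), hν1] at hlt
      exact lt_irrefl _ hlt
    have hdrift := dual_drift_le hμ1 hν1 hM hμint hνint hε₂ hε
      (d := fun x => ε₂ * Real.log (uOf K μ (sinkV K μ ν v0 ℓ) x) - α₁ x)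
      (e := fun y => β₁ y - ε₂ * Real.log (sinkV K μ ν v0 (ℓ + 1) y)) h1row h1col
      (fun x => by
        simp only [← hπexp]
        exact sum_uOf_mul_sinkV_le hKpos hμ hν hv0pos ℓ x)
      (fun y hy => by
        simp only [← hπexp]
        exact hcol y fun h => hy.ne' (he_init y h))
      (he_init y₀ hy₀).le x
    have hcard : ((Fintype.card X : ℝ) + Fintype.card Y) ≤ 2 * N := by
      have h1 : (Fintype.card X : ℝ) ≤ N := by exact_mod_cast hNX
      have h2 : (Fintype.card Y : ℝ) ≤ N := by exact_mod_cast hNY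
      linarith
    have h2 := mul_le_mul_of_nonneg_right hcard (by positivity : 0 ≤ 2 * ε₁ * Real.log M)
    have h3 : α₁ x / ε₂ + ε₁ / ε₂ * (4 * N * Real.log M) =
        (α₁ x + 2 * N * (2 * ε₁ * Real.log M)) / ε₂ := by
      field_simp
      ring
    rw [h3, le_div_iff₀ hε₂]
    linarith
  set C := N * (4 * Real.log N + 24 * Real.log M) + Real.log M with hC
  have hC0 : 0 ≤ C := by positivity
  have hgap : 0 < 1 - qt := by linarith
  set R := ε₁ / ε₂ * (C / (1 - qt)) with hR
  have hR0 : 0 ≤ R := by positivity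
  by_contra! hcon
  have hlt : ∀ ℓ : ℕ, (ℓ + 1 : ℝ) ≤ 2 + R → q (ℓ + 1) < qt := fun ℓ hℓ =>
    hcon (ℓ + 1) (by omega) (by exact_mod_cast hℓ)
  have hasc : ∀ m : ℕ, (m : ℝ) ≤ 2 + R → m * (1 - qt) ≤
      ∑ x, μ x * Real.log (uOf K μ (sinkV K μ ν v0 m) x) -
        ∑ x, μ x * Real.log (uOf K μ v0 x) := by
    intro m
    induction m with
    | zero => intro _; simp [sinkV]
    | succ m ih =>
      intro hm
      push_cast at hm ⊢
      have h1 := ih (by linarith)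
      have h2 := one_sub_mass_le_log_ascent hKpos hμ hμ1 (hUpos m) (hVpos (m + 1))
      rw [← hqs] at h2
      linarith [hlt m hm]
  have hfl : (⌊R⌋₊ : ℝ) ≤ R := Nat.floor_le hR0
  have hfl' : R < ⌊R⌋₊ + 1 := Nat.lt_floor_add_one R
  have h1 := hasc (⌊R⌋₊ + 1) (by push_cast; linarith)
  have h2 := hup (⌊R⌋₊ + 1) ((hlt _ (by push_cast; linarith)).trans hqt1)
  have h3 : ∑ x, μ x * Real.log (uOf K μ (sinkV K μ ν v0 (⌊R⌋₊ + 1)) x) -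
      ∑ x, μ x * Real.log (uOf K μ v0 x) ≤
      ∑ x, μ x * (ε₁ / ε₂ * (4 * N * Real.log M + Real.log M)) := by
    rw [← Finset.sum_sub_distrib]
    refine Finset.sum_le_sum fun x _ => ?_
    rw [← mul_sub]
    refine mul_le_mul_of_nonneg_left ?_ (hμ x).le
    linarith [h2 x, hlow x]
  rw [← Finset.sum_mul, hμ1, one_mul] at h3
  have h4 : 4 * N * Real.log M + Real.log M ≤ C := by
    have h5 : 0 ≤ (N : ℝ) * Real.log N := by positivity
    have h6 : 0 ≤ (N : ℝ) * Real.log M := by positivity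
    rw [hC]
    nlinarith
  have h5 := mul_le_mul_of_nonneg_left h4 ha.le
  have h6 : R * (1 - qt) = ε₁ / ε₂ * C := by
    rw [hR]
    field_simp
  have h7 := mul_lt_mul_of_pos_right hfl' hgap
  push_cast at h1
  linarith
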